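/- arXiv:2212.13548 — 2 statements merged into one kernel-verified Lean document; each statement's English description precedes it below -/
import Mathlib

section
/- Let K₁, ..., Kₙ be convex bodies in ℝⁿ. The mixed volume V(K₁,...,Kₙ) is positive if and only if for every subset I ⊆ [n], the dimension of the Minkowski sum ∑_{i∈I} K_i is at least |I|. -/
open MeasureTheory Topology
open scoped Pointwise

theorem rado_aux {ι E : Type*} [DecidableEq ι] [AddCommGroup E] [Module ℝ E] [FiniteDimensional ℝ E]
    (W : ι → Submodule ℝ E) (N : ℕ) : ∀ (s : Finset ι) (_ : s.card = N) (U : Submodule ℝ E),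
    (∀ I ⊆ s, I.card + Module.finrank ℝ U ≤ Module.finrank ℝ ↥(U ⊔ I.sup W)) →
    ∃ u : ι → E, (∀ i ∈ s, u i ∈ W i) ∧
      s.card + Module.finrank ℝ U ≤
        Module.finrank ℝ ↥(U ⊔ s.sup (fun i => Submodule.span ℝ {u i})) := by
  induction N using Nat.strong_induction_on with
  | _ N ih =>
  intro s hs U hU
  rcases s.eq_empty_or_nonempty with rfl | hne
  · refine ⟨0, by simp, ?_⟩
    rw [Finset.sup_empty, sup_bot_eq]
    simp
  by_cases hT : ∃ I ⊂ s, I.Nonempty ∧ Module.finrank ℝ ↥(U ⊔ I.sup W) = I.card + Module.finrank ℝ U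
  · obtain ⟨I, hIs, hIne, hI⟩ := hT
    have hIc : I.card < s.card := Finset.card_lt_card hIs
    obtain ⟨u, hu, hud⟩ := ih I.card (hs ▸ hIc) I rfl U (fun J hJ => hU J (hJ.trans hIs.1))
    have hle : U ⊔ I.sup (fun i => Submodule.span ℝ {u i}) ≤ U ⊔ I.sup W := by
      refine sup_le_sup le_rfl (Finset.sup_mono_fun fun i hi => ?_)
      simpa using hu i hi
    have heq : U ⊔ I.sup (fun i => Submodule.span ℝ {u i}) = U ⊔ I.sup W :=
      Submodule.eq_of_le_of_finrank_le hle (by omega)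
    have hcard := Finset.card_sdiff_add_card_eq_card hIs.1
    have hIpos := hIne.card_pos
    obtain ⟨u', hu', hud'⟩ := ih (s \ I).card (by omega) (s \ I) rfl (U ⊔ I.sup W) (by
      intro J hJ
      have h1 := hU (I ∪ J) (Finset.union_subset hIs.1 (hJ.trans Finset.sdiff_subset))
      have hd : Disjoint I J := (Finset.disjoint_sdiff.mono_right hJ)
      rw [Finset.card_union_of_disjoint hd, Finset.sup_union, ← sup_assoc] at h1
      omega)
    refine ⟨fun i => if i ∈ I then u i else u' i, ?_, ?_⟩
    · intro i hi
      by_cases h : i ∈ I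
      · simpa [h] using hu i h
      · simpa [h] using hu' i (by simp [hi, h])
    · have e1 : s.sup (fun i => Submodule.span ℝ {if i ∈ I then u i else u' i}) =
          I.sup (fun i => Submodule.span ℝ {u i}) ⊔ (s \ I).sup (fun i => Submodule.span ℝ {u' i}) := by
        conv_lhs => rw [← Finset.union_sdiff_of_subset hIs.1, Finset.sup_union]
        congr 1
        · exact Finset.sup_congr rfl (fun i hi => by simp [hi])
        · exact Finset.sup_congr rfl (fun i hi => by simp [(Finset.mem_sdiff.1 hi).2])
      rw [e1, ← sup_assoc, heq]
      omega
  · push Not at hT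
    obtain ⟨i, hi⟩ := hne
    have h1 := hU {i} (by simpa using hi)
    have : ∃ u ∈ W i, u ∉ U := by
      by_contra! hcon
      have : W i ≤ U := hcon
      rw [Finset.sup_singleton, sup_eq_left.2 this] at h1
      simp at h1
    obtain ⟨u, huW, huU⟩ := this
    have hlt : U < U ⊔ Submodule.span ℝ {u} := by
      refine lt_of_le_of_ne le_sup_left (fun h => huU ?_)
      rw [h]
      exact Submodule.mem_sup_right (Submodule.mem_span_singleton_self u)
    have hf1 := Submodule.finrank_lt_finrank_of_lt hlt
    have hf2 := (Submodule.finrank_add_le_finrank_add_finrank U (Submodule.span ℝ {u})).trans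
      (Nat.add_le_add_left (finrank_span_singleton (K := ℝ) (v := u) (fun h => huU (h ▸ U.zero_mem))).le _)
    have hc := Finset.card_erase_add_one hi
    obtain ⟨u', hu', hud'⟩ := ih (s.erase i).card (by omega) (s.erase i) rfl
      (U ⊔ Submodule.span ℝ {u}) (by
      intro J hJ
      rcases J.eq_empty_or_nonempty with rfl | hJne
      · rw [Finset.sup_empty, sup_bot_eq]; simp
      have h2 := hU J (hJ.trans (Finset.erase_subset _ _))
      have h3 := hT J (lt_of_le_of_lt hJ (Finset.erase_ssubset hi)) hJne
      have h4 : Module.finrank ℝ ↥(U ⊔ J.sup W) ≤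
         Module.finrank ℝ ↥(U ⊔ Submodule.span ℝ {u} ⊔ J.sup W) :=
        Submodule.finrank_mono (sup_le_sup le_sup_left le_rfl)
      omega)
    refine ⟨Function.update u' i u, ?_, ?_⟩
    · intro j hj
      by_cases h : j = i
      · subst h; simpa using huW
      · simpa [h] using hu' j (by simp [hj, h])
    · have e1 : s.sup (fun j => Submodule.span ℝ {Function.update u' i u j}) =
          Submodule.span ℝ {u} ⊔ (s.erase i).sup (fun i => Submodule.span ℝ {u' i}) := by
        conv_lhs => rw [← Finset.insert_erase hi, Finset.sup_insert]
        congr 1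
        · simp
        · exact Finset.sup_congr rfl (fun j hj => by simp [Finset.ne_of_mem_erase hj])
      rw [e1, ← sup_assoc]
      omega

theorem rado {n : ℕ} {E : Type*} [AddCommGroup E] [Module ℝ E] [FiniteDimensional ℝ E]
    (W : Fin n → Submodule ℝ E)
    (h : ∀ I : Finset (Fin n), I.card ≤ Module.finrank ℝ ↥(I.sup W)) :
    ∃ u : Fin n → E, (∀ i, u i ∈ W i) ∧ LinearIndependent ℝ u := by
  obtain ⟨u, hu, hd⟩ := rado_aux W _ Finset.univ rfl ⊥ (by intro I _; rw [bot_sup_eq]; simpa using h I)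
  refine ⟨u, fun i => hu i (Finset.mem_univ i), ?_⟩
  rw [linearIndependent_iff_card_le_finrank_span]
  have : Finset.univ.sup (fun i => Submodule.span ℝ {u i}) = Submodule.span ℝ (Set.range u) := by
    rw [Finset.sup_univ_eq_iSup, Submodule.span_range_eq_iSup]
  rw [this, bot_sup_eq] at hd
  simpa [Set.finrank] using hd

theorem polar_aux {n : ℕ} (a : (Fin n → Fin n) → ℝ) :
    ∑ U : Finset (Fin n), (-1 : ℝ) ^ U.card *
      ∑ f : Fin n → Fin n, a f * ∏ j, (if f j ∈ U then (0 : ℝ) else 1) =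
    ∑ σ : Equiv.Perm (Fin n), a σ := by
  classical
  have key : ∀ f : Fin n → Fin n, ∑ U : Finset (Fin n), (-1 : ℝ) ^ U.card *
      ∏ j, (if f j ∈ U then (0 : ℝ) else 1) = if Function.Surjective f then 1 else 0 := by
    intro f
    have h1 : ∀ U : Finset (Fin n), ∏ j, (if f j ∈ U then (0 : ℝ) else 1) =
        if U ∈ ((Finset.univ.image f)ᶜ).powerset then 1 else 0 := by
      intro U
      split_ifs with h
      · refine Finset.prod_eq_one fun j _ => ?_
        rw [if_neg]
        intro hj
        have := Finset.mem_powerset.1 h hj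
        simp at this
      · rw [Finset.mem_powerset, Finset.not_subset] at h
        obtain ⟨u, hu, hu2⟩ := h
        simp only [Finset.mem_compl, not_not, Finset.mem_image, Finset.mem_univ, true_and] at hu2
        obtain ⟨j, rfl⟩ := hu2
        exact Finset.prod_eq_zero (Finset.mem_univ j) (by simp [hu])
    simp_rw [h1, mul_ite, mul_one, mul_zero]
    rw [Finset.sum_ite_mem, Finset.univ_inter]
    have h2 := Finset.sum_powerset_neg_one_pow_card (x := (Finset.univ.image f)ᶜ)
    have h3 : (∑ m ∈ ((Finset.univ.image f)ᶜ).powerset, (-1 : ℝ) ^ m.card) =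
        ((if (Finset.univ.image f)ᶜ = ∅ then 1 else 0 : ℤ) : ℝ) := by
      rw [← h2]; push_cast; rfl
    rw [h3]
    have h4 : (Finset.univ.image f)ᶜ = ∅ ↔ Function.Surjective f := by
      rw [Finset.compl_eq_empty_iff, Finset.eq_univ_iff_forall]; simp [Function.Surjective]
    simp [h4]
  simp_rw [Finset.mul_sum]
  rw [Finset.sum_comm]
  have : ∀ f : Fin n → Fin n, ∑ U : Finset (Fin n), (-1 : ℝ) ^ U.card *
      (a f * ∏ j, (if f j ∈ U then (0 : ℝ) else 1)) = if Function.Surjective f then a f else 0 := by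
    intro f
    have h := congrArg (fun z => a f * z) (key f)
    simp only [Finset.mul_sum, mul_ite, mul_one, mul_zero] at h
    rw [← h]
    refine Finset.sum_congr rfl fun U _ => by ring
  simp_rw [this]
  symm
  refine Finset.sum_of_injOn (fun σ : Equiv.Perm (Fin n) => (σ : Fin n → Fin n)) ?_ ?_ ?_ ?_
  · exact fun σ _ τ _ h => DFunLike.coe_injective h
  · simp
  · intro f _ hf
    rw [if_neg]
    intro hs
    exact hf ⟨Equiv.ofBijective f (Finite.surjective_iff_bijective.1 hs), by simp, by ext; simp⟩
  · intro σ _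
    simp [σ.surjective]

theorem det_sum_smul {n : ℕ} (M : Fin n → Matrix (Fin n) (Fin n) ℝ) (t : Fin n → ℝ) :
    (∑ i, t i • M i).det =
      ∑ f : Fin n → Fin n, Matrix.det (Matrix.of fun j => M (f j) j) * ∏ j, t (f j) := by
  have h := (Matrix.detRowAlternating (R := ℝ) (n := Fin n)).toMultilinearMap.map_sum
    (fun j i => t i • M i j)
  have e1 : (∑ i, t i • M i) = Matrix.of fun j => ∑ i, t i • M i j := by
    ext j l
    simp [Matrix.sum_apply]
  rw [e1]
  refine h.trans (Finset.sum_congr rfl fun f _ => ?_)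
  rw [MultilinearMap.map_smul_univ, smul_eq_mul, mul_comm]
  rfl

theorem mixed_disc_sq {n : ℕ} (B : Fin n → Matrix (Fin n) (Fin n) ℝ) :
    ∑ σ : Equiv.Perm (Fin n), Matrix.det (Matrix.of fun j => ((B (σ j)).transpose * B (σ j)) j) =
    ∑ k : Fin n → Fin n, (Matrix.det (Matrix.of fun i => B i (k i))) ^ 2 := by
  have h1 : ∀ σ : Equiv.Perm (Fin n),
      Matrix.det (Matrix.of fun j => ((B (σ j)).transpose * B (σ j)) j) =
      ∑ k : Fin n → Fin n, (∏ j, B (σ j) (k (σ j)) j) *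
        (((Equiv.Perm.sign σ : ℤ) : ℝ) * Matrix.det (Matrix.of fun i => B i (k i))) := by
    intro σ
    have h := (Matrix.detRowAlternating (R := ℝ) (n := Fin n)).toMultilinearMap.map_sum
      (fun j k => B (σ j) k j • B (σ j) k)
    have e1 : (Matrix.of fun j => ((B (σ j)).transpose * B (σ j)) j) =
        Matrix.of fun j => ∑ k, B (σ j) k j • B (σ j) k := by
      ext j l
      simp [Matrix.mul_apply]
    rw [e1]
    refine h.trans ?_
    rw [← Equiv.sum_comp (Equiv.arrowCongr σ.symm (Equiv.refl (Fin n)))]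
    refine Finset.sum_congr rfl fun k _ => ?_
    rw [MultilinearMap.map_smul_univ, smul_eq_mul, ← Matrix.det_permute]
    rfl
  simp_rw [h1]
  rw [Finset.sum_comm]
  refine Finset.sum_congr rfl fun k _ => ?_
  rw [sq]
  nth_rewrite 2 [Matrix.det_apply']
  rw [Finset.sum_mul]
  refine Finset.sum_congr rfl fun σ _ => ?_
  simp only [Matrix.of_apply]
  ring

theorem mixed_disc_pos {n : ℕ} (M : Fin n → Matrix (Fin n) (Fin n) ℝ)
    (hM : ∀ i, (M i).PosSemidef) (W : Fin n → Submodule ℝ (EuclideanSpace ℝ (Fin n)))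
    (hW : ∀ i (w : EuclideanSpace ℝ (Fin n)), (M i).mulVec w.ofLp = 0 ↔ w ∈ (W i)ᗮ) :
    0 ≤ ∑ σ : Equiv.Perm (Fin n), Matrix.det (Matrix.of fun j => M (σ j) j) ∧
    (0 < ∑ σ : Equiv.Perm (Fin n), Matrix.det (Matrix.of fun j => M (σ j) j) ↔
      ∀ I : Finset (Fin n), I.card ≤ Module.finrank ℝ ↥(I.sup W)) := by
  have hB : ∀ i, ∃ B : Matrix (Fin n) (Fin n) ℝ, M i = B.transpose * B := by
    intro i
    open scoped MatrixOrder in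
    obtain ⟨B, hB⟩ := CStarAlgebra.nonneg_iff_eq_star_mul_self.mp (hM i).nonneg
    refine ⟨B, ?_⟩
    rw [hB, Matrix.star_eq_conjTranspose, Matrix.conjTranspose_eq_transpose_of_trivial]
  choose B hB using hB
  have hsq : ∑ σ : Equiv.Perm (Fin n), Matrix.det (Matrix.of fun j => M (σ j) j) =
      ∑ k : Fin n → Fin n, (Matrix.det (Matrix.of fun i => B i (k i))) ^ 2 := by
    rw [← mixed_disc_sq]
    simp_rw [hB]
  rw [hsq]
  have hnn : 0 ≤ ∑ k : Fin n → Fin n, (Matrix.det (Matrix.of fun i => B i (k i))) ^ 2 :=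
    Finset.sum_nonneg fun k _ => sq_nonneg _
  refine ⟨hnn, ?_⟩
  set b : Fin n → Fin n → EuclideanSpace ℝ (Fin n) := fun i k => WithLp.toLp 2 (B i k) with hb
  have hspan : ∀ i, Submodule.span ℝ (Set.range (b i)) = W i := by
    intro i
    rw [← Submodule.orthogonal_orthogonal (W i),
      ← Submodule.orthogonal_orthogonal (Submodule.span ℝ (Set.range (b i)))]
    congr 1
    ext w
    rw [← hW i w, hB i]
    have h1 := Matrix.conjTranspose_mul_self_mulVec_eq_zero (B i) w.ofLp
    rw [Matrix.conjTranspose_eq_transpose_of_trivial] at h1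
    rw [h1, Submodule.mem_orthogonal]
    constructor
    · intro h
      ext k
      have := h (b i k) (Submodule.subset_span ⟨k, rfl⟩)
      rw [PiLp.inner_apply] at this
      simpa [Matrix.mulVec, dotProduct, hb, mul_comm] using this
    · intro h u hu
      induction hu using Submodule.span_induction with
      | mem x hx =>
        obtain ⟨k, rfl⟩ := hx
        have := congrFun h k
        rw [PiLp.inner_apply]
        simpa [Matrix.mulVec, dotProduct, hb, mul_comm] using this
      | zero => simp
      | add x y _ _ hx hy => rw [inner_add_left, hx, hy, add_zero]
      | smul c x _ hx => rw [inner_smul_left, hx, mul_zero]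
  have hdet : ∀ u : Fin n → EuclideanSpace ℝ (Fin n),
      Matrix.det (Matrix.of fun i => (u i).ofLp) ≠ 0 ↔ LinearIndependent ℝ u := by
    intro u
    rw [← isUnit_iff_ne_zero, ← Matrix.isUnit_iff_isUnit_det,
      ← Matrix.linearIndependent_rows_iff_isUnit]
    exact LinearMap.linearIndependent_iff (v := u)
      (WithLp.linearEquiv 2 ℝ (Fin n → ℝ)).toLinearMap (LinearEquiv.ker _)
  have hpos : 0 < ∑ k : Fin n → Fin n, (Matrix.det (Matrix.of fun i => B i (k i))) ^ 2 ↔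
      ∃ k : Fin n → Fin n, Matrix.det (Matrix.of fun i => B i (k i)) ≠ 0 := by
    rw [Finset.sum_pos_iff_of_nonneg (fun k _ => sq_nonneg _)]
    constructor
    · rintro ⟨k, -, hk⟩
      exact ⟨k, fun h => by simp [h] at hk⟩
    · rintro ⟨k, hk⟩
      exact ⟨k, Finset.mem_univ _, by positivity⟩
  rw [hpos]
  constructor
  · rintro ⟨k, hk⟩ I
    have hli : LinearIndependent ℝ (fun i => b i (k i)) := (hdet _).1 hk
    have hli2 : LinearIndependent ℝ (fun i : I => b i (k i)) := hli.comp _ Subtype.val_injective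
    have h1 := finrank_span_eq_card hli2
    rw [Fintype.card_coe] at h1
    rw [← h1]
    refine Submodule.finrank_mono (Submodule.span_le.2 ?_)
    rintro _ ⟨i, rfl⟩
    refine (Finset.le_sup (f := W) i.2) ?_
    rw [← hspan]
    exact Submodule.subset_span ⟨_, rfl⟩
  · intro h
    obtain ⟨u, hu, hli⟩ := rado W h
    by_contra! hcon
    refine (hdet u).2 hli ?_
    have : ∀ i, ∃ c : Fin n → ℝ, ∑ k, c k • b i k = u i := by
      intro i
      have := hu i
      rw [← hspan i] at this
      exact (Submodule.mem_span_range_iff_exists_fun ℝ).1 this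
    choose c hc using this
    have e1 : (Matrix.of fun i => (u i).ofLp) = Matrix.of fun i => ∑ k, c i k • B i k := by
      ext i l
      simp [← hc i, hb]
    rw [e1]
    have h := (Matrix.detRowAlternating (R := ℝ) (n := Fin n)).toMultilinearMap.map_sum
      (fun i k => c i k • B i k)
    refine h.trans (Finset.sum_eq_zero fun k _ => ?_)
    rw [MultilinearMap.map_smul_univ]
    have h2 := hcon k
    change (∏ i, c i (k i)) • Matrix.det (Matrix.of fun i => B i (k i)) = 0
    rw [h2, smul_zero]

theorem vectorSpan_add_sets {E : Type*} [AddCommGroup E] [Module ℝ E] (s t : Set E)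
    (hs : s.Nonempty) (ht : t.Nonempty) :
    vectorSpan ℝ (s + t) = vectorSpan ℝ s ⊔ vectorSpan ℝ t := by
  obtain ⟨s0, hs0⟩ := hs
  obtain ⟨t0, ht0⟩ := ht
  apply le_antisymm
  · rw [vectorSpan_def, Submodule.span_le]
    rintro _ ⟨_, ⟨a, ha, b, hb, rfl⟩, _, ⟨a', ha', b', hb', rfl⟩, rfl⟩
    have : (a + b) -ᵥ (a' + b') = (a -ᵥ a') + (b -ᵥ b') := by
      simp only [vsub_eq_sub]; abel
    change (a + b) -ᵥ (a' + b') ∈ _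
    rw [this]
    exact Submodule.add_mem_sup (vsub_mem_vectorSpan ℝ ha ha') (vsub_mem_vectorSpan ℝ hb hb')
  · refine sup_le ?_ ?_
    · rw [vectorSpan_def, Submodule.span_le]
      rintro _ ⟨a, ha, a', ha', rfl⟩
      have := vsub_mem_vectorSpan ℝ (Set.add_mem_add ha ht0) (Set.add_mem_add ha' ht0)
      simpa using this
    · rw [vectorSpan_def, Submodule.span_le]
      rintro _ ⟨a, ha, a', ha', rfl⟩
      have := vsub_mem_vectorSpan ℝ (Set.add_mem_add hs0 ha) (Set.add_mem_add hs0 ha')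
      simpa using this

theorem vectorSpan_sum_sets {ι E : Type*} [AddCommGroup E] [Module ℝ E] (K : ι → Set E)
    (hK : ∀ i, (K i).Nonempty) (I : Finset ι) :
    (∑ i ∈ I, K i).Nonempty ∧
    vectorSpan ℝ (∑ i ∈ I, K i) = I.sup (fun i => vectorSpan ℝ (K i)) := by
  classical
  induction I using Finset.induction_on with
  | empty => exact ⟨by simp, by simp [← Set.singleton_zero]⟩
  | insert a s ha ih =>
    rw [Finset.sum_insert ha, Finset.sup_insert]
    exact ⟨(hK a).add ih.1, by rw [vectorSpan_add_sets _ _ (hK a) ih.1, ih.2]⟩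

theorem expint_hasFDerivAt {E F : Type*} [NormedAddCommGroup E] [InnerProductSpace ℝ E]
    [FiniteDimensional ℝ E]
    [NormedAddCommGroup F] [NormedSpace ℝ F] [FiniteDimensional ℝ F]
    (ν : Measure ℕ) [IsFiniteMeasure ν] (v : ℕ → E) (M : ℝ) (hM : ∀ k, ‖v k‖ ≤ M)
    (c : ℕ → F) (C : ℝ) (hC : ∀ k, ‖c k‖ ≤ C) (x : E) :
    HasFDerivAt (fun x => ∫ k, Real.exp (inner ℝ (v k) x) • c k ∂ν)
      (∫ k, Real.exp (inner ℝ (v k) x) • (innerSL ℝ (v k)).smulRight (c k) ∂ν) x := by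
  have hM0 : 0 ≤ M := (norm_nonneg _).trans (hM 0)
  have hC0 : 0 ≤ C := (norm_nonneg _).trans (hC 0)
  have hexp : ∀ k, ∀ y ∈ Metric.ball x 1, Real.exp (inner ℝ (v k) y) ≤ Real.exp (M * (‖x‖ + 1)) := by
    intro k y hy
    apply Real.exp_le_exp.2
    refine (real_inner_le_norm _ _).trans ?_
    have : ‖y‖ ≤ ‖x‖ + 1 := by
      have := norm_sub_norm_le y x
      rw [← dist_eq_norm] at this
      have h2 := Metric.mem_ball.1 hy
      linarith
    exact mul_le_mul (hM k) this (norm_nonneg _) hM0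
  refine hasFDerivAt_integral_of_dominated_of_fderiv_le (s := Metric.ball x 1)
    (F := fun x k => Real.exp (inner ℝ (v k) x) • c k)
    (F' := fun x k => Real.exp (inner ℝ (v k) x) • (innerSL ℝ (v k)).smulRight (c k))
    (bound := fun _ => Real.exp (M * (‖x‖ + 1)) * (M * C))
    (Metric.ball_mem_nhds x one_pos) ?_ ?_ ?_ ?_ ?_ ?_
  · exact Filter.Eventually.of_forall fun y => (StronglyMeasurable.of_discrete).aestronglyMeasurable
  · refine Integrable.of_bound (C := Real.exp (M * (‖x‖ + 1)) * C)
      (StronglyMeasurable.of_discrete).aestronglyMeasurable (Filter.Eventually.of_forall fun k => ?_)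
    rw [norm_smul, Real.norm_eq_abs, Real.abs_exp]
    exact mul_le_mul (hexp k x (Metric.mem_ball_self one_pos)) (hC k) (norm_nonneg _) (Real.exp_pos _).le
  · exact (StronglyMeasurable.of_discrete).aestronglyMeasurable
  · refine Filter.Eventually.of_forall fun k y hy => ?_
    rw [norm_smul, Real.norm_eq_abs, Real.abs_exp, ContinuousLinearMap.norm_smulRight_apply,
      innerSL_apply_norm]
    exact mul_le_mul (hexp k y hy) (mul_le_mul (hM k) (hC k) (norm_nonneg _) hM0) (by positivity)
      (Real.exp_pos _).le
  · exact integrable_const _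
  · refine Filter.Eventually.of_forall fun k y hy => ?_
    have h1 : HasFDerivAt (fun y : E => Real.exp (inner ℝ (v k) y))
        (Real.exp (inner ℝ (v k) y) • innerSL ℝ (v k)) y :=
      ((innerSL ℝ (v k)).hasFDerivAt (x := y)).exp
    convert h1.smul_const (c k) using 1
    ext w
    simp [mul_smul]

theorem body_potential {E : Type} [NormedAddCommGroup E] [InnerProductSpace ℝ E]
    [FiniteDimensional ℝ E] (K : Set E) (hc : IsCompact K) (hconv : Convex ℝ K) (hne : K.Nonempty) :
    ∃ (φ : E → ℝ) (T : E → E) (A : E → E →L[ℝ] E),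
      (∀ x, HasFDerivAt φ (innerSL ℝ (T x)) x) ∧ (∀ x, HasFDerivAt T (A x) x) ∧ (∀ x, T x ∈ K) ∧
      (∀ x w z, inner ℝ (A x w) z = inner ℝ w (A x z)) ∧
      (∀ x w, 0 ≤ inner ℝ (A x w) w) ∧
      (∀ x w, inner ℝ (A x w) w = 0 ↔ ∀ a ∈ K, ∀ b ∈ K, inner ℝ (a - b) w = 0) ∧
      (∀ x w, (∀ a ∈ K, ∀ b ∈ K, inner ℝ (a - b) w = 0) → A x w = 0) ∧
      (∀ δ > 0, ∃ C : ℝ, ∀ x, ∀ a ∈ K, inner ℝ a x - δ * ‖x‖ - C ≤ φ x) := by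
  -- dense sequence
  have hneK : Nonempty K := hne.to_subtype
  obtain ⟨v', hv'⟩ := TopologicalSpace.exists_dense_seq K
  set v : ℕ → E := fun k => (v' k : E) with hvdef
  have hvK : ∀ k, v k ∈ K := fun k => (v' k).2
  have hdense : ∀ a ∈ K, ∀ ε > 0, ∃ k, dist a (v k) < ε := by
    intro a ha ε hε
    obtain ⟨k, hk⟩ := hv'.exists_dist_lt ⟨a, ha⟩ hε
    exact ⟨k, by simpa [Subtype.dist_eq] using hk⟩
  obtain ⟨M, hM'⟩ := hc.isBounded.exists_norm_le
  have hM : ∀ k, ‖v k‖ ≤ M := fun k => hM' _ (hvK k)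
  have hM0 : 0 ≤ M := (norm_nonneg _).trans (hM 0)
  -- the measure
  obtain ⟨ν, hνf, hν⟩ : ∃ ν : Measure ℕ, IsFiniteMeasure ν ∧ ∀ k, 0 < ν {k} := by
    refine ⟨(Measure.count : Measure ℕ).toFinite, inferInstance, fun k => ?_⟩
    rw [pos_iff_ne_zero]
    intro h
    have := absolutelyContinuous_toFinite (Measure.count : Measure ℕ) h
    simp at this
  have hae : ∀ p : ℕ → Prop, (∀ᵐ k ∂ν, p k) → ∀ k, p k := by
    intro p hp k
    by_contra hk
    have h0 : ν {k | ¬ p k} = 0 := hp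
    exact (hν k).ne' (measure_mono_null (by simpa using hk) h0)
  have hnz : NeZero ν := ⟨fun h => by have := hν 0; simp [h] at this⟩
  set e : E → ℕ → ℝ := fun x k => Real.exp (inner ℝ (v k) x) with he
  have hepos : ∀ x k, 0 < e x k := fun x k => Real.exp_pos _
  have heb : ∀ x k, e x k ≤ Real.exp (M * ‖x‖) := fun x k => Real.exp_le_exp.2
    ((real_inner_le_norm _ _).trans (mul_le_mul_of_nonneg_right (hM k) (norm_nonneg _)))
  have hint : ∀ {F : Type} [NormedAddCommGroup F] [NormedSpace ℝ F] (x : E) (c : ℕ → F) (C : ℝ)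
      (_ : ∀ k, ‖c k‖ ≤ C), Integrable (fun k => e x k • c k) ν := by
    intro F _ _ x c C hC
    refine Integrable.of_bound (C := Real.exp (M * ‖x‖) * C)
      ?_ (Filter.Eventually.of_forall fun k => ?_)
    · exact AEStronglyMeasurable.of_discrete
    · rw [norm_smul, Real.norm_eq_abs, abs_of_pos (hepos x k)]
      exact mul_le_mul (heb x k) (hC k) (norm_nonneg _) (Real.exp_pos _).le
  have hint1 : ∀ x, Integrable (e x) ν := fun x => by
    simpa using hint x (fun _ => (1 : ℝ)) 1 (by simp)
  set Z : E → ℝ := fun x => ∫ k, e x k ∂ν with hZ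
  set S : E → E := fun x => ∫ k, e x k • v k ∂ν with hS
  have hZpos : ∀ x, 0 < Z x := fun x => integral_exp_pos (hint1 x)
  set T : E → E := fun x => (Z x)⁻¹ • S x with hT
  set DS : E → E →L[ℝ] E := fun x => ∫ k, e x k • (innerSL ℝ (v k)).smulRight (v k) ∂ν with hDS
  have hSd : ∀ x, HasFDerivAt S (DS x) x := fun x => expint_hasFDerivAt ν v M hM v M hM x
  have hiS : ∀ x w, inner ℝ (S x) w = ∫ k, e x k * inner ℝ (v k) w ∂ν := by
    intro x w
    change inner ℝ (∫ k, e x k • v k ∂ν) w = _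
    rw [real_inner_comm, ← integral_inner (hint x v M hM)]
    congr 1; ext k
    rw [real_inner_smul_right, real_inner_comm]
  have hZd : ∀ x, HasFDerivAt Z (innerSL ℝ (S x)) x := by
    intro x
    have h := expint_hasFDerivAt ν v M hM (fun _ => (1:ℝ)) 1 (by simp) x
    simp only [smul_eq_mul, mul_one] at h
    refine h.congr_fderiv ?_
    symm
    ext1 w
    rw [ContinuousLinearMap.integral_apply]
    · simpa using hiS x w
    · refine hint x _ (M * 1) fun k => ?_
      rw [ContinuousLinearMap.norm_smulRight_apply, innerSL_apply_norm]
      simpa using hM k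
  set A : E → E →L[ℝ] E := fun x => (Z x)⁻¹ • (DS x - (innerSL ℝ (S x)).smulRight (T x)) with hA
  have hTd : ∀ x, HasFDerivAt T (A x) x := by
    intro x
    have h1 := ((hasDerivAt_inv (hZpos x).ne').comp_hasFDerivAt x (hZd x)).smul (hSd x)
    refine h1.congr_fderiv ?_
    ext1 w
    have := (hZpos x).ne'
    simp only [hA, hT, Function.comp, _root_.add_apply, _root_.smul_apply,
      ContinuousLinearMap.smulRight_apply, _root_.sub_apply, smul_sub, smul_smul,
      smul_eq_mul]
    rw [sub_eq_add_neg, ← neg_smul]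
    congr 2
    field_simp
  have hbdw : ∀ w k, |inner ℝ (v k) w| ≤ M * ‖w‖ := fun w k =>
    (abs_real_inner_le_norm _ _).trans (mul_le_mul_of_nonneg_right (hM k) (norm_nonneg _))
  have hDSi : ∀ x w z, inner ℝ (DS x w) z = ∫ k, e x k * (inner ℝ (v k) w * inner ℝ (v k) z) ∂ν := by
    intro x w z
    have hI : Integrable (fun k => e x k • (innerSL ℝ (v k)).smulRight (v k)) ν := by
      refine hint x _ (M * M) fun k => ?_
      rw [ContinuousLinearMap.norm_smulRight_apply, innerSL_apply_norm]
      exact mul_le_mul (hM k) (hM k) (norm_nonneg _) hM0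
    change inner ℝ ((∫ k, e x k • (innerSL ℝ (v k)).smulRight (v k) ∂ν) w) z = _
    rw [ContinuousLinearMap.integral_apply hI, real_inner_comm,
      ← integral_inner (hI.apply_continuousLinearMap w)]
    congr 1; ext k
    simp [real_inner_smul_right, real_inner_comm z]
  have hTS : ∀ x, S x = Z x • T x := fun x => by
    rw [hT, smul_smul, mul_inv_cancel₀ (hZpos x).ne', one_smul]
  have hAi : ∀ x w z, inner ℝ (A x w) z =
      (Z x)⁻¹ * ∫ k, e x k * (inner ℝ (v k - T x) w * inner ℝ (v k - T x) z) ∂ν := by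
    intro x w z
    have e1 : ∀ k, e x k * (inner ℝ (v k - T x) w * inner ℝ (v k - T x) z) =
        e x k * (inner ℝ (v k) w * inner ℝ (v k) z) - inner ℝ (T x) z * (e x k * inner ℝ (v k) w)
        - inner ℝ (T x) w * (e x k * inner ℝ (v k) z) + (inner ℝ (T x) w * inner ℝ (T x) z) * e x k := by
      intro k
      simp only [inner_sub_left]; ring
    have i1 : Integrable (fun k => e x k * (inner ℝ (v k) w * inner ℝ (v k) z)) ν := 
      hint x (fun k => (inner ℝ (v k) w * inner ℝ (v k) z : ℝ)) ((M * ‖w‖) * (M * ‖z‖)) (fun k => by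
        rw [Real.norm_eq_abs, abs_mul]
        exact mul_le_mul (hbdw w k) (hbdw z k) (abs_nonneg _) (by positivity))
    have i2 : ∀ w, Integrable (fun k => e x k * inner ℝ (v k) w) ν := fun w =>
      hint x (fun k => (inner ℝ (v k) w : ℝ)) (M * ‖w‖) (hbdw w)
    simp_rw [e1]
    have j1 : Integrable (fun k => e x k * (inner ℝ (v k) w * inner ℝ (v k) z) -
        inner ℝ (T x) z * (e x k * inner ℝ (v k) w)) ν := i1.sub ((i2 w).const_mul _)
    have j2 : Integrable (fun k => e x k * (inner ℝ (v k) w * inner ℝ (v k) z) -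
        inner ℝ (T x) z * (e x k * inner ℝ (v k) w) -
        inner ℝ (T x) w * (e x k * inner ℝ (v k) z)) ν := j1.sub ((i2 z).const_mul _)
    rw [integral_add j2 ((hint1 x).const_mul _),
      integral_sub j1 ((i2 z).const_mul _),
      integral_sub i1 ((i2 w).const_mul _), integral_const_mul, integral_const_mul,
      integral_const_mul, ← hiS, ← hiS, ← hDSi]
    change _ = (Z x)⁻¹ * (_ - _ - _ + _ * Z x)
    simp only [hA, _root_.smul_apply, _root_.sub_apply,
      ContinuousLinearMap.smulRight_apply, innerSL_apply_apply, real_inner_smul_left, inner_sub_left]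
    congr 1
    simp only [hTS x, real_inner_smul_left]
    ring
  have hTK : ∀ x, T x ∈ K := by
    intro x
    have := isProbabilityMeasure_tilted (hint1 x)
    have h := hconv.integral_mem (μ := ν.tilted (fun k => inner ℝ (v k) x)) (f := v) hc.isClosed
      (Filter.Eventually.of_forall hvK)
      (Integrable.of_bound AEStronglyMeasurable.of_discrete M (Filter.Eventually.of_forall hM))
    rw [integral_tilted] at h
    have e1 : T x = ∫ k, (Real.exp (inner ℝ (v k) x) / ∫ k, Real.exp (inner ℝ (v k) x) ∂ν) • v k ∂ν := by
      change (Z x)⁻¹ • (∫ k, e x k • v k ∂ν) = _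
      rw [← integral_smul]
      congr 1; ext1 k
      rw [smul_smul, div_eq_inv_mul]
    rw [e1]; exact h
  have hTb : ∀ x, ‖T x‖ ≤ M := fun x => hM' _ (hTK x)
  refine ⟨fun x => Real.log (Z x), T, A, ?_, hTd, hTK, ?_, ?_, ?_, ?_, ?_⟩
  · intro x
    refine ((hZd x).log (hZpos x).ne').congr_fderiv ?_
    ext w
    simp [hT]
  · intro x w z
    rw [real_inner_comm (A x z) w, hAi, hAi]
    congr 2; ext k; ring
  · intro x w
    rw [hAi]
    exact mul_nonneg (inv_pos.2 (hZpos x)).le (integral_nonneg fun k =>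
      mul_nonneg (hepos x k).le (mul_self_nonneg _))
  · intro x w
    rw [hAi, mul_eq_zero, or_iff_right (inv_ne_zero (hZpos x).ne'), integral_eq_zero_iff_of_nonneg
      (fun k => mul_nonneg (hepos x k).le (mul_self_nonneg _)) (by
        refine hint x (fun k => (inner ℝ (v k - T x) w * inner ℝ (v k - T x) w : ℝ))
          ((2 * M * ‖w‖) * (2 * M * ‖w‖)) (fun k => ?_)
        rw [Real.norm_eq_abs, abs_mul]
        have : |inner ℝ (v k - T x) w| ≤ 2 * M * ‖w‖ :=
          (abs_real_inner_le_norm _ _).trans (mul_le_mul_of_nonneg_right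
            ((norm_sub_le _ _).trans (by linarith [hM k, hTb x])) (norm_nonneg _))
        exact mul_le_mul this this (abs_nonneg _) (by positivity))]
    constructor
    · intro h
      have h1 : ∀ k, inner ℝ (v k) w = inner ℝ (T x) w := by
        intro k
        have := hae _ h k
        simp only [Pi.zero_apply, mul_eq_zero, (hepos x k).ne', false_or, or_self, inner_sub_left] at this
        linarith
      have h2 : ∀ a ∈ K, inner ℝ a w = inner ℝ (T x) w := by
        intro a ha
        have hcl : IsClosed {y : K | inner ℝ (y : E) w = inner ℝ (T x) w} :=
          isClosed_eq (by fun_prop) continuous_const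
        have := hcl.closure_subset_iff.2 (Set.range_subset_iff.2 h1)
        exact this (hv' ⟨a, ha⟩)
      intro a ha b hb
      rw [inner_sub_left, h2 a ha, h2 b hb, sub_self]
    · intro h
      refine Filter.Eventually.of_forall fun k => ?_
      simp [h _ (hvK k) _ (hTK x)]
  · intro x w h
    refine ext_inner_right ℝ fun z => ?_
    rw [hAi, inner_zero_left]
    have : ∀ k, inner ℝ (v k - T x) w = 0 := fun k => h _ (hvK k) _ (hTK x)
    simp [this]
  · intro δ hδ
    obtain ⟨t, ht⟩ := hc.elim_finite_subcover (fun k => Metric.ball (v k) δ)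
      (fun k => Metric.isOpen_ball) (fun a ha => by
        obtain ⟨k, hk⟩ := hdense a ha δ hδ
        exact Set.mem_iUnion.2 ⟨k, hk⟩)
    refine ⟨∑ k ∈ t, |Real.log (ν.real {k})|, fun x a ha => ?_⟩
    obtain ⟨k, hkt, hk⟩ := Set.mem_iUnion₂.1 (ht ha)
    have hνk : 0 < ν.real {k} := ENNReal.toReal_pos (hν k).ne' (measure_ne_top _ _)
    have h1 : e x k * ν.real {k} ≤ Z x := by
      have : ∫ j in {k}, e x j ∂ν ≤ Z x :=
        setIntegral_le_integral (hint1 x) (Filter.Eventually.of_forall fun j => (hepos x j).le)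
      rwa [integral_singleton, smul_eq_mul, mul_comm] at this
    have h2 := Real.log_le_log (mul_pos (hepos x k) hνk) h1
    rw [Real.log_mul (hepos x k).ne' hνk.ne', he, Real.log_exp] at h2
    have h3 : |Real.log (ν.real {k})| ≤ ∑ k ∈ t, |Real.log (ν.real {k})| :=
      Finset.single_le_sum (f := fun k => |Real.log (ν.real {k})|) (fun _ _ => abs_nonneg _) hkt
    have h4 : inner ℝ (a - v k) x ≤ δ * ‖x‖ := (real_inner_le_norm _ _).trans
      (mul_le_mul_of_nonneg_right (by rw [← dist_eq_norm]; exact (Metric.mem_ball.1 hk).le) (norm_nonneg _))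
    rw [inner_sub_left] at h4
    have h5 := neg_abs_le (Real.log (ν.real {k}))
    linarith

theorem vol_formula {ι E : Type} [Fintype ι] [NormedAddCommGroup E] [InnerProductSpace ℝ E]
    [FiniteDimensional ℝ E] [MeasurableSpace E] [BorelSpace E]
    (K : ι → Set E) (hK : ∀ i, IsCompact (K i) ∧ Convex ℝ (K i) ∧ (K i).Nonempty)
    (φ : ι → E → ℝ) (T : ι → E → E) (A : ι → E → E →L[ℝ] E)
    (hφ : ∀ i x, HasFDerivAt (φ i) (innerSL ℝ (T i x)) x)
    (hT : ∀ i x, HasFDerivAt (T i) (A i x) x) (hTK : ∀ i x, T i x ∈ K i)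
    (hnn : ∀ i x w, 0 ≤ inner ℝ (A i x w) w)
    (hker : ∀ i x w, inner ℝ (A i x w) w = 0 ↔ ∀ a ∈ K i, ∀ b ∈ K i, inner ℝ (a - b) w = 0)
    (hker2 : ∀ i x w, (∀ a ∈ K i, ∀ b ∈ K i, inner ℝ (a - b) w = 0) → A i x w = 0)
    (hco : ∀ i, ∀ δ > 0, ∃ C : ℝ, ∀ x, ∀ a ∈ K i, inner ℝ a x - δ * ‖x‖ - C ≤ φ i x)
    (t : ι → ℝ) (ht : ∀ i, 0 ≤ t i) :
    volume (∑ i, t i • K i) = ∫⁻ x, ENNReal.ofReal |(∑ i, t i • A i x).det| := by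
  set f : E → E := fun x => ∑ i, t i • T i x with hf
  have hfd : ∀ x, HasFDerivAt f (∑ i, t i • A i x) x := fun x =>
    HasFDerivAt.fun_sum fun i _ => (hT i x).const_smul (t i)
  have hconv : Convex ℝ (∑ i, t i • K i) :=
    convex_sum _ fun i _ => ((hK i).2.1).smul _
  have hsub : Set.range f ⊆ ∑ i, t i • K i := by
    rintro _ ⟨x, rfl⟩
    exact Set.mem_fintype_sum _ _ |>.2 ⟨fun i => t i • T i x, fun i =>
      Set.smul_mem_smul_set (hTK i x), rfl⟩
  have hsup : interior (∑ i, t i • K i) ⊆ Set.range f := by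
    intro y hy
    obtain ⟨r, hr, hball⟩ := Metric.nhds_basis_closedBall.mem_iff.1 (mem_interior_iff_mem_nhds.1 hy)
    have hts : 0 ≤ ∑ i, t i := Finset.sum_nonneg fun i _ => ht i
    set δ : ℝ := r / (2 * (1 + ∑ i, t i)) with hδ
    have hδpos : 0 < δ := by positivity
    have hδ2 : δ * ∑ i, t i ≤ r / 2 := by
      have : δ * (1 + ∑ i, t i) = r / 2 := by rw [hδ]; field_simp
      nlinarith
    choose C hC using fun i => hco i δ hδpos
    set F : E → ℝ := fun x => ∑ i, t i * φ i x - inner ℝ y x with hF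
    have hFd : ∀ x, HasFDerivAt F (∑ i, t i • innerSL ℝ (T i x) - innerSL ℝ y) x := fun x =>
      (HasFDerivAt.fun_sum fun i _ => (hφ i x).const_mul (t i)).sub (innerSL ℝ y).hasFDerivAt
    have hlow : ∀ x, r / 2 * ‖x‖ - ∑ i, t i * C i ≤ F x := by
      intro x
      have hz : y + (r / ‖x‖) • x ∈ ∑ i, t i • K i := by
        apply hball
        rw [Metric.mem_closedBall, dist_eq_norm, add_sub_cancel_left, norm_smul, norm_div, norm_norm,
          Real.norm_eq_abs, abs_of_pos hr]
        by_cases hx : ‖x‖ = 0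
        · simp [hx, hr.le]
        · rw [div_mul_cancel₀ _ hx]
      obtain ⟨g, hg, hgs⟩ := (Set.mem_fintype_sum _ _).1 hz
      choose a ha hag using fun i => Set.mem_smul_set.1 (hg i)
      have h1 : inner ℝ y x + r * ‖x‖ = ∑ i, t i * inner ℝ (a i) x := by
        have : inner ℝ (y + (r / ‖x‖) • x) x = ∑ i, t i * inner ℝ (a i) x := by
          rw [← hgs, sum_inner]
          refine Finset.sum_congr rfl fun i _ => ?_
          rw [← hag, real_inner_smul_left]
        rw [← this, inner_add_left, real_inner_smul_left, real_inner_self_eq_norm_sq]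
        by_cases hx : ‖x‖ = 0
        · simp [hx]
        · field_simp
      have h2 : ∑ i, t i * inner ℝ (a i) x ≤ ∑ i, t i * (φ i x + δ * ‖x‖ + C i) :=
        Finset.sum_le_sum fun i _ => mul_le_mul_of_nonneg_left (by linarith [hC i x (a i) (ha i)]) (ht i)
      simp only [mul_add, Finset.sum_add_distrib, ← Finset.sum_mul] at h2
      have h3 : (∑ i, t i) * (δ * ‖x‖) ≤ r / 2 * ‖x‖ := by
        have := mul_le_mul_of_nonneg_right hδ2 (norm_nonneg x)
        linarith
      simp only [hF]
      linarith
    have hcoer : Filter.Tendsto F (Filter.cocompact E) Filter.atTop := by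
      refine Filter.tendsto_atTop_mono hlow ?_
      exact Filter.tendsto_atTop_add_const_right _ _
        ((tendsto_norm_cocompact_atTop (E := E)).const_mul_atTop (by positivity))
    have hFc : Continuous F := continuous_iff_continuousAt.2 fun x => (hFd x).continuousAt
    obtain ⟨x, hx⟩ := hFc.exists_forall_le hcoer
    have hmin : IsLocalMin F x := Filter.Eventually.of_forall hx
    have h0 := hmin.hasFDerivAt_eq_zero (hFd x)
    refine ⟨x, ?_⟩
    refine ext_inner_right ℝ fun w => ?_
    have := DFunLike.congr_fun h0 w
    simp [sub_eq_zero] at this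
    rw [← this, hf, sum_inner]
    simp [real_inner_smul_left]
  have hvol : volume (∑ i, t i • K i) = volume (f '' Set.univ) := by
    rw [Set.image_univ]
    refine le_antisymm ?_ (measure_mono hsub)
    calc volume (∑ i, t i • K i) ≤ volume (interior (∑ i, t i • K i) ∪ frontier (∑ i, t i • K i)) :=
          measure_mono (by rw [← closure_eq_interior_union_frontier]; exact subset_closure)
      _ ≤ volume (interior (∑ i, t i • K i)) + volume (frontier (∑ i, t i • K i)) :=
          measure_union_le _ _
      _ = volume (interior (∑ i, t i • K i)) := by rw [hconv.addHaar_frontier volume, add_zero]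
      _ ≤ _ := measure_mono hsup
  rw [hvol]
  by_cases hdet : ∀ x, (∑ i, t i • A i x).det = 0
  · rw [addHaar_image_eq_zero_of_det_fderivWithin_eq_zero volume
      (fun x _ => (hfd x).hasFDerivWithinAt) (fun x _ => hdet x)]
    simp [hdet]
  · push Not at hdet
    obtain ⟨x0, hx0⟩ := hdet
    have hpos : ∀ x w, w ≠ 0 → 0 < inner ℝ ((∑ i, t i • A i x) w) w := by
      intro x w hw
      have e1 : inner ℝ ((∑ i, t i • A i x) w) w = ∑ i, t i * inner ℝ (A i x w) w := by
        simp [sum_inner, real_inner_smul_left]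
      rw [e1]
      refine lt_of_le_of_ne (Finset.sum_nonneg fun i _ => mul_nonneg (ht i) (hnn i x w)) ?_
      intro h
      have h1 := (Finset.sum_eq_zero_iff_of_nonneg
        (fun i _ => mul_nonneg (ht i) (hnn i x w))).1 h.symm
      have h2 : (∑ i, t i • A i x0) w = 0 := by
        simp only [_root_.sum_apply, _root_.smul_apply]
        refine Finset.sum_eq_zero fun i hi => ?_
        rcases mul_eq_zero.1 (h1 i hi) with h3 | h3
        · rw [h3, zero_smul]
        · rw [hker2 i x0 w ((hker i x w).1 h3), smul_zero]
      apply hx0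
      have : ((∑ i, t i • A i x0 : E →L[ℝ] E) : E →ₗ[ℝ] E).det = 0 := by
        by_contra hne
        have := (LinearMap.equivOfDetNeZero _ hne).injective
        refine hw (this ?_)
        simpa using h2
      exact this
    have hinj : Function.Injective f := by
      intro x y hxy
      by_contra hne
      have hw : y - x ≠ 0 := sub_ne_zero.2 (Ne.symm hne)
      set h : ℝ → ℝ := fun s => inner ℝ (f (x + s • (y - x))) (y - x) with hh
      have hd : ∀ s, HasDerivAt h
          (inner ℝ ((∑ i, t i • A i (x + s • (y - x))) (y - x)) (y - x)) s := by
        intro s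
        have hl : HasDerivAt (fun s : ℝ => x + s • (y - x)) (y - x) s := by
          simpa using ((hasDerivAt_id s).smul_const (y - x)).const_add x
        have := (hfd (x + s • (y - x))).comp_hasDerivAt s hl
        simpa using this.inner ℝ (hasDerivAt_const s (y - x))
      have hmono : StrictMono h := strictMono_of_deriv_pos fun s => by
        rw [(hd s).deriv]; exact hpos _ _ hw
      have := hmono (zero_lt_one)
      simp [hh, hxy] at this
    rw [← lintegral_abs_det_fderiv_eq_addHaar_image volume MeasurableSet.univ
      (fun x _ => (hfd x).hasFDerivWithinAt) hinj.injOn, setLIntegral_univ]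

theorem finrank_le_iff_sup {n : ℕ} (K : Fin n → Set (EuclideanSpace ℝ (Fin n)))
    (hK : ∀ i, (K i).Nonempty) (I : Finset (Fin n)) :
    I.card ≤ Module.finrank ℝ (vectorSpan ℝ (∑ i ∈ I, K i)) ↔
      I.card ≤ Module.finrank ℝ ↥(I.sup (fun i => vectorSpan ℝ (K i))) := by
  rw [(vectorSpan_sum_sets K hK I).2]

/-- Schneider's characterization of the positivity of mixed volumes: given convex
bodies `K₁, ..., Kₙ` in `ℝⁿ` and the mixed-volume function `V` (the symmetric
multilinear function with
`vol (t₁K₁ + ⋯ + tₙKₙ) = ∑ V (K_{f 1},...,K_{f n}) t_{f 1}⋯t_{f n}`), the mixed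
volume `V(K₁,...,Kₙ)` is positive if and only if for every `I ⊆ [n]` the Minkowski
sum `∑_{i ∈ I} K i` has dimension (of its affine hull) at least `|I|`. -/
theorem mixedVolume_pos_iff_dim_sum_ge
    (n : ℕ) (K : Fin n → Set (EuclideanSpace ℝ (Fin n)))
    (hK : ∀ i, IsCompact (K i) ∧ Convex ℝ (K i) ∧ (K i).Nonempty)
    (V : (Fin n → Set (EuclideanSpace ℝ (Fin n))) → ℝ)
    (hV : ∀ L : Fin n → Set (EuclideanSpace ℝ (Fin n)),
      (∀ i, IsCompact (L i) ∧ Convex ℝ (L i) ∧ (L i).Nonempty) →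
      ∀ t : Fin n → ℝ, (∀ i, 0 ≤ t i) →
        (volume (∑ i, t i • L i)).toReal = ∑ f : Fin n → Fin n, V (L ∘ f) * ∏ i, t (f i))
    (hsymm : ∀ (L : Fin n → Set (EuclideanSpace ℝ (Fin n))) (σ : Equiv.Perm (Fin n)),
      V (L ∘ σ) = V L) :
    0 < V K ↔ ∀ I : Finset (Fin n),
      I.card ≤ Module.finrank ℝ (vectorSpan ℝ (∑ i ∈ I, K i)) := by
  choose φ T A hφ hT hTK hsym hnn hker hker2 hco using
    fun i => body_potential (K i) (hK i).1 (hK i).2.1 (hK i).2.2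
  set M : Fin n → EuclideanSpace ℝ (Fin n) → Matrix (Fin n) (Fin n) ℝ :=
    fun i x => Matrix.toEuclideanLin.symm (A i x : _ →ₗ[ℝ] _) with hMdef
  have hMA : ∀ i x, Matrix.toEuclideanLin (M i x) = (A i x : _ →ₗ[ℝ] _) := fun i x =>
    LinearEquiv.apply_symm_apply _ _
  have hMv : ∀ i x (w : EuclideanSpace ℝ (Fin n)), (M i x).mulVec w.ofLp = (A i x w).ofLp := by
    intro i x w
    have := LinearMap.congr_fun (hMA i x) w
    exact congrArg WithLp.ofLp this
  have hdot : ∀ v w : EuclideanSpace ℝ (Fin n), inner ℝ v w = w.ofLp ⬝ᵥ v.ofLp := by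
    intro v w
    rw [PiLp.inner_apply]
    simp [dotProduct]
  have hMpsd : ∀ i x, (M i x).PosSemidef := by
    intro i x
    refine Matrix.PosSemidef.of_dotProduct_mulVec_nonneg ?_ ?_
    · ext j l
      rw [Matrix.conjTranspose_apply, star_trivial]
      have h := hsym i x (EuclideanSpace.single j 1) (EuclideanSpace.single l 1)
      rw [hdot, hdot, ← hMv, ← hMv] at h
      simpa using h
    · intro y
      have h := hnn i x (WithLp.toLp 2 y)
      rw [hdot, ← hMv] at h
      simpa using h
  have hMW : ∀ i x (w : EuclideanSpace ℝ (Fin n)),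
      (M i x).mulVec w.ofLp = 0 ↔ w ∈ (vectorSpan ℝ (K i))ᗮ := by
    intro i x w
    rw [hMv]
    have h1 : (A i x w).ofLp = 0 ↔ A i x w = 0 := by
      constructor
      · intro h
        ext j
        exact congrFun h j
      · intro h
        rw [h]; rfl
    rw [h1]
    have h2 : A i x w = 0 ↔ ∀ a ∈ K i, ∀ b ∈ K i, inner ℝ (a - b) w = 0 :=
      ⟨fun h => (hker i x w).1 (by rw [h, inner_zero_left]), hker2 i x w⟩
    rw [h2, Submodule.mem_orthogonal]
    constructor
    · intro h u hu
      rw [vectorSpan_def] at hu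
      induction hu using Submodule.span_induction with
      | mem z hz =>
        obtain ⟨a, ha, b, hb, rfl⟩ := hz
        exact h a ha b hb
      | zero => simp
      | add x y _ _ hx hy => rw [inner_add_left, hx, hy, add_zero]
      | smul c x _ hx => rw [inner_smul_left, hx, mul_zero]
    · intro h a ha b hb
      exact h _ (vsub_mem_vectorSpan ℝ ha hb)
  -- determinants
  have hdet : ∀ (t : Fin n → ℝ) x, (∑ i, t i • A i x).det = (∑ i, t i • M i x).det := by
    intro t x
    have h1 : ((∑ i, t i • A i x : _ →L[ℝ] _) : EuclideanSpace ℝ (Fin n) →ₗ[ℝ] _) =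
        Matrix.toEuclideanLin (∑ i, t i • M i x) := by
      rw [map_sum]
      simp_rw [map_smul, hMA]
      ext w : 1
      simp
    change LinearMap.det ((∑ i, t i • A i x : _ →L[ℝ] _) : EuclideanSpace ℝ (Fin n) →ₗ[ℝ] _) = _
    rw [h1, Matrix.toEuclideanLin_eq_toLin_orthonormal, LinearMap.det_toLin]
  have hdetnn : ∀ (t : Fin n → ℝ), (∀ i, 0 ≤ t i) → ∀ x, 0 ≤ (∑ i, t i • M i x).det := by
    intro t ht x
    exact (Matrix.posSemidef_sum _ fun i _ => (hMpsd i x).smul (ht i)).det_nonneg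
  have hvol : ∀ (t : Fin n → ℝ), (∀ i, 0 ≤ t i) →
      Integrable (fun x => (∑ i, t i • M i x).det) ∧
      (volume (∑ i, t i • K i)).toReal = ∫ x, (∑ i, t i • M i x).det := by
    intro t ht
    have h := vol_formula K hK φ T A hφ hT hTK hnn hker hker2 hco t ht
    simp_rw [hdet] at h
    have habs : ∀ x, |(∑ i, t i • M i x).det| = (∑ i, t i • M i x).det := fun x =>
      abs_of_nonneg (hdetnn t ht x)
    simp_rw [habs] at h
    have hcomp : IsCompact (∑ i, t i • K i) := by
      have : ∀ s : Finset (Fin n), IsCompact (∑ i ∈ s, t i • K i) := by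
        intro s
        induction s using Finset.induction_on with
        | empty => simp [← Set.singleton_zero]
        | insert a s ha ih =>
          rw [Finset.sum_insert ha]
          exact ((hK a).1.smul (t a)).add ih
      exact this Finset.univ
    have hfin : volume (∑ i, t i • K i) < ⊤ := hcomp.measure_lt_top
    have hmeas : AEStronglyMeasurable (fun x => (∑ i, t i • M i x).det) volume := by
      have hfd : ∀ x, HasFDerivAt (fun x => ∑ i, t i • T i x) (∑ i, t i • A i x) x := fun x =>
        HasFDerivAt.fun_sum fun i _ => (hT i x).const_smul (t i)
      have h1 := aemeasurable_ofReal_abs_det_fderivWithin volume MeasurableSet.univ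
        (fun x _ => (hfd x).hasFDerivWithinAt)
      simp_rw [hdet, habs, Measure.restrict_univ] at h1
      have h2 := h1.ennreal_toReal
      simp_rw [ENNReal.toReal_ofReal (hdetnn t ht _)] at h2
      exact h2.aestronglyMeasurable
    refine ⟨⟨hmeas, ?_⟩, ?_⟩
    · rw [hasFiniteIntegral_iff_ofReal (Filter.Eventually.of_forall (hdetnn t ht)), ← h]
      exact hfin
    · rw [h, integral_eq_lintegral_of_nonneg_ae (Filter.Eventually.of_forall (hdetnn t ht)) hmeas]
  -- polarization
  set g : EuclideanSpace ℝ (Fin n) → ℝ := fun x =>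
    ∑ σ : Equiv.Perm (Fin n), Matrix.det (Matrix.of fun j => M (σ j) x j) with hg
  set τ : Finset (Fin n) → Fin n → ℝ := fun U i => if i ∈ U then 0 else 1 with hτ
  have hτnn : ∀ U i, 0 ≤ τ U i := by
    intro U i
    simp only [hτ]
    split_ifs <;> norm_num
  have hgp : ∀ x, g x = ∑ U : Finset (Fin n), (-1 : ℝ) ^ U.card * (∑ i, τ U i • M i x).det := by
    intro x
    have h := polar_aux (fun f => Matrix.det (Matrix.of fun j => M (f j) x j))
    simp only [hg]
    rw [← h]
    refine Finset.sum_congr rfl fun U _ => ?_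
    rw [det_sum_smul]
  have hgint : Integrable g := by
    have : g = fun x => ∑ U : Finset (Fin n), (-1 : ℝ) ^ U.card * (∑ i, τ U i • M i x).det :=
      funext hgp
    rw [this]
    exact integrable_finsetSum _ fun U _ => (hvol (τ U) (hτnn U)).1.const_mul _
  have hmain : (n.factorial : ℝ) * V K = ∫ x, g x := by
    simp_rw [hgp]
    rw [integral_finsetSum _ fun U _ => (hvol (τ U) (hτnn U)).1.const_mul _]
    simp_rw [integral_const_mul]
    have h := polar_aux (fun f => V (K ∘ f))
    simp_rw [hsymm] at h
    rw [Finset.sum_const, Finset.card_univ, Fintype.card_perm, Fintype.card_fin, nsmul_eq_mul] at h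
    rw [← h]
    refine Finset.sum_congr rfl fun U _ => ?_
    rw [← (hvol (τ U) (hτnn U)).2, hV K hK (τ U) (hτnn U)]
  have hmd := fun x => mixed_disc_pos (fun i => M i x) (fun i => hMpsd i x)
    (fun i => vectorSpan ℝ (K i)) (fun i w => hMW i x w)
  have hgnn : ∀ x, 0 ≤ g x := fun x => (hmd x).1
  have hfac : (0 : ℝ) < n.factorial := by exact_mod_cast n.factorial_pos
  have hVpos : 0 < V K ↔ 0 < ∫ x, g x := by
    rw [← hmain]
    exact (mul_pos_iff_of_pos_left hfac).symm
  simp_rw [finrank_le_iff_sup K (fun i => (hK i).2.2)]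
  rw [hVpos]
  constructor
  · intro h
    by_contra hcon
    have : ∀ x, g x = 0 := fun x =>
      le_antisymm (not_lt.1 fun hx => hcon ((hmd x).2.1 hx)) (hgnn x)
    simp [this] at h
  · intro h
    have hp : ∀ x, 0 < g x := fun x => (hmd x).2.2 h
    rw [integral_pos_iff_support_of_nonneg hgnn hgint]
    have : Function.support g = Set.univ := Set.eq_univ_of_forall fun x => (hp x).ne'
    rw [this]
    exact Measure.measure_univ_pos.2 (NeZero.ne _)
end

section
/- Let 1 ≤ k ≤ n−p−q and let α₁, ..., α_k be positive semidefinite Hermitian forms on ℂⁿ, viewed as real (1,1)-forms. Suppose that the sum α₁+⋯+α_k has rank at most k+p+q−1, with p,q ≥ 1. Then the linear map Λ^{p,q}(ℂⁿ) → Λ^{p+k,q+k}(ℂⁿ) given by wedge product with α₁∧⋯∧α_k is not injective. -/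
open Matrix
open scoped ComplexOrder

/-- The generator `dz i` of the complexified exterior algebra on `ℂⁿ`,
where the index set `Fin n ⊕ Fin n` records the generators `dz₁,...,dzₙ`
(left summand) and `dz̄₁,...,dz̄ₙ` (right summand). -/
noncomputable def dzGen (n : ℕ) (i : Fin n) : ExteriorAlgebra ℂ (Fin n ⊕ Fin n → ℂ) :=
  ExteriorAlgebra.ι ℂ (Pi.single (Sum.inl i) 1)

/-- The generator `dz̄ j`. -/
noncomputable def dzbarGen (n : ℕ) (j : Fin n) : ExteriorAlgebra ℂ (Fin n ⊕ Fin n → ℂ) :=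
  ExteriorAlgebra.ι ℂ (Pi.single (Sum.inr j) 1)

/-- The `(1,1)`-form `∑ A i j • dz i ∧ dz̄ j` associated with a Hermitian matrix `A`. -/
noncomputable def oneOneForm (n : ℕ) (A : Matrix (Fin n) (Fin n) ℂ) :
    ExteriorAlgebra ℂ (Fin n ⊕ Fin n → ℂ) :=
  ∑ i : Fin n, ∑ j : Fin n, A i j • (dzGen n i * dzbarGen n j)

/-- The space `Λ^{p,q}(ℂⁿ)` of `(p,q)`-forms with constant coefficients,
realized inside the exterior algebra as the span of the monomials
`dz_{I 1} ∧ ⋯ ∧ dz_{I p} ∧ dz̄_{J 1} ∧ ⋯ ∧ dz̄_{J q}`. -/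
noncomputable def LambdaPQ (n p q : ℕ) :
    Submodule ℂ (ExteriorAlgebra ℂ (Fin n ⊕ Fin n → ℂ)) :=
  Submodule.span ℂ
    {x | ∃ (I : Fin p → Fin n) (J : Fin q → Fin n),
      x = (List.ofFn fun a => dzGen n (I a)).prod * (List.ofFn fun b => dzbarGen n (J b)).prod}

namespace WNI
open TensorProduct

lemma choose_lt (p q k m : ℕ) (hp : 1 ≤ p) (hq : 1 ≤ q) (hk : 1 ≤ k) (hm : m + 1 = k + p + q) :
    m.choose (p + k) * m.choose (q + k) < m.choose p * m.choose q := by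
  obtain ⟨a, rfl⟩ := Nat.exists_eq_add_of_le' hp
  obtain ⟨b, rfl⟩ := Nat.exists_eq_add_of_le' hq
  have h1 := Nat.choose_succ_right_eq m a
  have h2 := Nat.choose_succ_right_eq m b
  rw [show m - a = k + b + 1 by omega] at h1
  rw [show m - b = k + a + 1 by omega] at h2
  have h3 : m.choose (a + 1 + k) = m.choose b := by
    rw [← Nat.choose_symm (by omega)]; congr 1; omega
  have h4 : m.choose (b + 1 + k) = m.choose a := by
    rw [← Nat.choose_symm (by omega)]; congr 1; omega
  rw [h3, h4]
  have ha : 0 < m.choose a := Nat.choose_pos (by omega)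
  have hb : 0 < m.choose b := Nat.choose_pos (by omega)
  have hab : 0 < m.choose b * m.choose a := Nat.mul_pos hb ha
  have key : (m.choose (a+1) * m.choose (b+1)) * ((a+1)*(b+1)) =
      (m.choose b * m.choose a) * ((k+b+1)*(k+a+1)) := by
    calc _ = (m.choose (a+1) * (a+1)) * (m.choose (b+1) * (b+1)) := by ring
      _ = _ := by rw [h1, h2]; ring
  by_contra hcon
  push Not at hcon
  have h5 := Nat.mul_le_mul_right ((a+1)*(b+1)) hcon
  rw [key] at h5
  have h6 := Nat.le_of_mul_le_mul_left h5 hab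
  nlinarith

noncomputable def DZ (n : ℕ) : Submodule ℂ (ExteriorAlgebra ℂ (Fin n ⊕ Fin n → ℂ)) :=
  Submodule.span ℂ (Set.range (dzGen n))

noncomputable def DZb (n : ℕ) : Submodule ℂ (ExteriorAlgebra ℂ (Fin n ⊕ Fin n → ℂ)) :=
  Submodule.span ℂ (Set.range (dzbarGen n))

lemma lambda_eq (n p q : ℕ) : LambdaPQ n p q = DZ n ^ p * DZb n ^ q := by
  rw [DZ, DZb, Submodule.span_pow, Submodule.span_pow, Submodule.span_mul_span, LambdaPQ]
  congr 1
  ext x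
  simp only [Set.mem_setOf_eq, Set.mem_mul, Set.mem_pow]
  constructor
  · rintro ⟨I, J, rfl⟩
    exact ⟨_, ⟨fun a => ⟨_, I a, rfl⟩, rfl⟩, _, ⟨fun a => ⟨_, J a, rfl⟩, rfl⟩, rfl⟩
  · rintro ⟨_, ⟨f, rfl⟩, _, ⟨g, rfl⟩, rfl⟩
    choose I hI using fun a => (f a).2
    choose J hJ using fun a => (g a).2
    exact ⟨I, J, by simp only [hI, hJ]⟩

lemma swap (n : ℕ) : DZb n * DZ n = DZ n * DZb n := by
  rw [DZ, DZb, Submodule.span_mul_span, Submodule.span_mul_span]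
  have h : ∀ i j, dzbarGen n j * dzGen n i = -(dzGen n i * dzbarGen n j) := fun i j =>
    eq_neg_of_add_eq_zero_left (ExteriorAlgebra.ι_add_mul_swap _ _)
  apply le_antisymm
  · rw [Submodule.span_le]
    rintro _ ⟨_, ⟨j, rfl⟩, _, ⟨i, rfl⟩, rfl⟩
    simp only [h]
    exact neg_mem (Submodule.subset_span ⟨_, ⟨i, rfl⟩, _, ⟨j, rfl⟩, rfl⟩)
  · rw [Submodule.span_le]
    rintro _ ⟨_, ⟨i, rfl⟩, _, ⟨j, rfl⟩, rfl⟩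
    have := h i j
    simp only
    rw [← neg_neg (dzGen n i * dzbarGen n j), ← h]
    exact neg_mem (Submodule.subset_span ⟨_, ⟨j, rfl⟩, _, ⟨i, rfl⟩, rfl⟩)

lemma lambda_mul (n p q r s : ℕ) :
    LambdaPQ n p q * LambdaPQ n r s = LambdaPQ n (p + r) (q + s) := by
  simp only [lambda_eq]
  have h : Commute (DZb n) (DZ n) := swap n
  have h2 := (h.pow_pow q r).eq
  rw [pow_add, pow_add, mul_assoc, ← mul_assoc (DZb n ^ q), h2]
  simp only [mul_assoc]

lemma oneOne_mem (n : ℕ) (A) : oneOneForm n A ∈ LambdaPQ n 1 1 := by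
  rw [lambda_eq, pow_one, pow_one, oneOneForm]
  exact Submodule.sum_mem _ fun i _ => Submodule.sum_mem _ fun j _ => Submodule.smul_mem _ _
    (Submodule.mul_mem_mul (Submodule.subset_span ⟨i, rfl⟩) (Submodule.subset_span ⟨j, rfl⟩))

lemma prod_mem (n k : ℕ) (A : Fin k → Matrix (Fin n) (Fin n) ℂ) :
    (List.ofFn fun i => oneOneForm n (A i)).prod ∈ LambdaPQ n k k := by
  induction k with
  | zero => rw [lambda_eq]; simp
  | succ k ih =>
    have e : LambdaPQ n (k + 1) (k + 1) = LambdaPQ n 1 1 * LambdaPQ n k k := by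
      rw [lambda_mul, add_comm]
    rw [List.ofFn_succ, List.prod_cons, e]
    exact Submodule.mul_mem_mul (oneOne_mem _ _) (ih _)

/-- inclusion of first summand -/
noncomputable def iL (m : ℕ) : (Fin m → ℂ) →ₗ[ℂ] (Fin m ⊕ Fin m → ℂ) :=
  (LinearEquiv.sumArrowLequivProdArrow (Fin m) (Fin m) ℂ ℂ).symm.toLinearMap ∘ₗ LinearMap.inl _ _ _

noncomputable def iR (m : ℕ) : (Fin m → ℂ) →ₗ[ℂ] (Fin m ⊕ Fin m → ℂ) :=
  (LinearEquiv.sumArrowLequivProdArrow (Fin m) (Fin m) ℂ ℂ).symm.toLinearMap ∘ₗ LinearMap.inr _ _ _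

noncomputable def T (m : ℕ) :
    ExteriorAlgebra ℂ (Fin m → ℂ) ⊗[ℂ] ExteriorAlgebra ℂ (Fin m → ℂ) →ₗ[ℂ]
      ExteriorAlgebra ℂ (Fin m ⊕ Fin m → ℂ) :=
  TensorProduct.lift ((LinearMap.mul ℂ _).compl₁₂ (ExteriorAlgebra.map (iL m)).toLinearMap
    (ExteriorAlgebra.map (iR m)).toLinearMap)

lemma T_tmul (m : ℕ) (x y) : T m (x ⊗ₜ y) =
  ExteriorAlgebra.map (iL m) x * ExteriorAlgebra.map (iR m) y := rfl

noncomputable def iso (m : ℕ) : (0 : QuadraticForm ℂ (Fin m ⊕ Fin m → ℂ)) →qᵢ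
    ((0 : QuadraticForm ℂ (Fin m → ℂ)).prod (0 : QuadraticForm ℂ (Fin m → ℂ))) :=
  { (LinearEquiv.sumArrowLequivProdArrow (Fin m) (Fin m) ℂ ℂ).toLinearMap with
    map_app' := fun x => by simp }

lemma T_inj (m : ℕ) : Function.Injective (T m) := by
  let g := CliffordAlgebra.map (iso m)
  let Q0 : QuadraticForm ℂ (Fin m → ℂ) := 0
  let e := CliffordAlgebra.prodEquiv Q0 Q0
  have hL : g.comp (ExteriorAlgebra.map (iL m)) = CliffordAlgebra.map (.inl Q0 Q0) := by
    apply CliffordAlgebra.hom_ext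
    refine LinearMap.ext fun x => ?_
    simp only [g, LinearMap.comp_apply, AlgHom.toLinearMap_apply, AlgHom.comp_apply]
    erw [CliffordAlgebra.map_apply_ι, CliffordAlgebra.map_apply_ι, CliffordAlgebra.map_apply_ι]
    congr 1
  have hR : g.comp (ExteriorAlgebra.map (iR m)) = CliffordAlgebra.map (.inr Q0 Q0) := by
    apply CliffordAlgebra.hom_ext
    refine LinearMap.ext fun x => ?_
    simp only [g, LinearMap.comp_apply, AlgHom.toLinearMap_apply, AlgHom.comp_apply]
    erw [CliffordAlgebra.map_apply_ι, CliffordAlgebra.map_apply_ι, CliffordAlgebra.map_apply_ι]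
    congr 1
  have key : ∀ z, g (T m z) = e.symm
      (GradedTensorProduct.of ℂ (CliffordAlgebra.evenOdd Q0) (CliffordAlgebra.evenOdd Q0) z) := by
    intro z
    induction z with
    | zero => simp
    | add a b ha hb => simp only [map_add, ha, hb]
    | tmul x y =>
      rw [T_tmul, map_mul]
      have h1 := DFunLike.congr_fun hL x
      have h2 := DFunLike.congr_fun hR y
      simp only [AlgHom.comp_apply] at h1 h2
      rw [h1, h2]
      change _ = CliffordAlgebra.toProd Q0 Q0 (GradedTensorProduct.tmul ℂ x y)
      rw [CliffordAlgebra.toProd, GradedTensorProduct.lift_tmul]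
  intro x y h
  have := congrArg g h
  rw [key, key] at this
  exact (GradedTensorProduct.of ℂ _ _).injective (e.symm.injective this)

lemma DZ_eq (m : ℕ) : DZ m = (LinearMap.range (ExteriorAlgebra.ι ℂ (M := Fin m → ℂ))).map
    (ExteriorAlgebra.map (iL m)).toLinearMap := by
  rw [← Submodule.map_top, ← (Pi.basisFun ℂ (Fin m)).span_eq, Submodule.map_span, Submodule.map_span,
    DZ, ← Set.range_comp, ← Set.range_comp]
  congr 2
  ext i : 1
  simp only [Function.comp_apply, AlgHom.toLinearMap_apply, ExteriorAlgebra.map_apply_ι, dzGen]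
  congr 1
  ext (j | j) <;> simp [iL, Pi.single_apply, LinearEquiv.sumArrowLequivProdArrow]

lemma DZb_eq (m : ℕ) : DZb m = (LinearMap.range (ExteriorAlgebra.ι ℂ (M := Fin m → ℂ))).map
    (ExteriorAlgebra.map (iR m)).toLinearMap := by
  rw [← Submodule.map_top, ← (Pi.basisFun ℂ (Fin m)).span_eq, Submodule.map_span, Submodule.map_span,
    DZb, ← Set.range_comp, ← Set.range_comp]
  congr 2
  ext i : 1
  simp only [Function.comp_apply, AlgHom.toLinearMap_apply, ExteriorAlgebra.map_apply_ι, dzbarGen]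
  congr 1
  ext (j | j) <;> simp [iR, Pi.single_apply, LinearEquiv.sumArrowLequivProdArrow]

lemma lambda_range (m p q : ℕ) : LambdaPQ m p q =
    LinearMap.range (T m ∘ₗ TensorProduct.mapIncl (⋀[ℂ]^p (Fin m → ℂ)) (⋀[ℂ]^q (Fin m → ℂ))) := by
  rw [lambda_eq, DZ_eq, DZb_eq, ← Submodule.map_pow, ← Submodule.map_pow]
  apply le_antisymm
  · rw [Submodule.mul_le]
    rintro _ ⟨x, hx, rfl⟩ _ ⟨y, hy, rfl⟩
    exact ⟨⟨x, hx⟩ ⊗ₜ ⟨y, hy⟩, rfl⟩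
  · rintro _ ⟨z, rfl⟩
    induction z with
    | zero => simp
    | add a b ha hb => rw [map_add]; exact add_mem ha hb
    | tmul x y => exact Submodule.mul_mem_mul ⟨x, x.2, rfl⟩ ⟨y, y.2, rfl⟩

lemma comp_inj (m p q : ℕ) : Function.Injective
    (T m ∘ₗ TensorProduct.mapIncl (⋀[ℂ]^p (Fin m → ℂ)) (⋀[ℂ]^q (Fin m → ℂ))) := by
  rw [LinearMap.coe_comp]
  exact (T_inj m).comp (TensorProduct.map_injective_of_flat_flat _ _
    (Submodule.subtype_injective _) (Submodule.subtype_injective _))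

lemma finrank_lambda (m p q : ℕ) :
    Module.finrank ℂ (LambdaPQ m p q) = m.choose p * m.choose q := by
  rw [lambda_range, LinearMap.finrank_range_of_inj (comp_inj m p q), Module.finrank_tensorProduct,
    exteriorPower.finrank_eq, exteriorPower.finrank_eq]
  simp

instance (m p q : ℕ) : Module.Finite ℂ (LambdaPQ m p q) := by
  rw [lambda_range]; infer_instance

lemma core (m p q k : ℕ) (hp : 1 ≤ p) (hq : 1 ≤ q) (hk : 1 ≤ k) (hm : m + 1 = k + p + q)
    (β : Fin k → Matrix (Fin m) (Fin m) ℂ) :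
    ∃ Φ, Φ ∈ LambdaPQ m p q ∧ Φ ≠ 0 ∧
      (List.ofFn fun i => oneOneForm m (β i)).prod * Φ = 0 := by
  set w := (List.ofFn fun i => oneOneForm m (β i)).prod with hw
  let F : LambdaPQ m p q →ₗ[ℂ] LambdaPQ m (p + k) (q + k) :=
    ((LinearMap.mulLeft ℂ w).comp (Submodule.subtype _)).codRestrict _ (by
      intro x
      rw [add_comm p, add_comm q, ← lambda_mul]
      exact Submodule.mul_mem_mul (prod_mem _ _ _) x.2)
  have h : LinearMap.ker F ≠ ⊥ := by
    apply LinearMap.ker_ne_bot_of_finrank_lt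
    rw [finrank_lambda, finrank_lambda]
    exact choose_lt p q k m hp hq hk hm
  obtain ⟨x, hx, hx0⟩ := (Submodule.ne_bot_iff _).mp h
  refine ⟨x, x.2, by simpa using hx0, ?_⟩
  exact congrArg Subtype.val (LinearMap.mem_ker.mp hx)

noncomputable def L {m n : ℕ} (C : Matrix (Fin n) (Fin m) ℂ) :
    (Fin m ⊕ Fin m → ℂ) →ₗ[ℂ] (Fin n ⊕ Fin n → ℂ) :=
  (Matrix.fromBlocks C 0 0 (C.map star)).mulVecLin

lemma map_dz {m n : ℕ} (C : Matrix (Fin n) (Fin m) ℂ) (a : Fin m) :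
    ExteriorAlgebra.map (L C) (dzGen m a) = ∑ i, C i a • dzGen n i := by
  simp only [dzGen, ExteriorAlgebra.map_apply_ι, ← map_smul, ← map_sum]
  congr 1
  ext (j | j) <;> simp [L, Matrix.mulVec_single, Pi.single_apply]

lemma map_dzb {m n : ℕ} (C : Matrix (Fin n) (Fin m) ℂ) (a : Fin m) :
    ExteriorAlgebra.map (L C) (dzbarGen m a) = ∑ i, star (C i a) • dzbarGen n i := by
  simp only [dzbarGen, ExteriorAlgebra.map_apply_ι, ← map_smul, ← map_sum]
  congr 1
  ext (j | j) <;> simp [L, Matrix.mulVec_single, Pi.single_apply]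

lemma map_oneOne {m n : ℕ} (C : Matrix (Fin n) (Fin m) ℂ) (β : Matrix (Fin m) (Fin m) ℂ) :
    ExteriorAlgebra.map (L C) (oneOneForm m β) = oneOneForm n (C * β * Cᴴ) := by
  simp only [oneOneForm, map_sum, map_smul, map_mul, map_dz, map_dzb, Matrix.mul_apply,
    Finset.sum_mul, Finset.mul_sum, Finset.smul_sum, Finset.sum_smul, smul_mul_smul_comm, smul_smul,
    Matrix.conjTranspose_apply]
  calc _ = ∑ a, ∑ b, ∑ i, ∑ j, (β a b * (C i a * star (C j b))) • (dzGen n i * dzbarGen n j) := by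
        refine Finset.sum_congr rfl fun a _ => Finset.sum_congr rfl fun b _ => ?_
        first | rfl | rw [Finset.sum_comm]
    _ = ∑ a, ∑ i, ∑ b, ∑ j, (β a b * (C i a * star (C j b))) • (dzGen n i * dzbarGen n j) :=
        Finset.sum_congr rfl fun a _ => Finset.sum_comm
    _ = ∑ i, ∑ a, ∑ b, ∑ j, (β a b * (C i a * star (C j b))) • (dzGen n i * dzbarGen n j) :=
        Finset.sum_comm
    _ = ∑ i, ∑ a, ∑ j, ∑ b, (β a b * (C i a * star (C j b))) • (dzGen n i * dzbarGen n j) :=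
        Finset.sum_congr rfl fun i _ => Finset.sum_congr rfl fun a _ => Finset.sum_comm
    _ = ∑ i, ∑ j, ∑ a, ∑ b, (β a b * (C i a * star (C j b))) • (dzGen n i * dzbarGen n j) :=
        Finset.sum_congr rfl fun i _ => Finset.sum_comm
    _ = ∑ i, ∑ j, ∑ b, ∑ a, (β a b * (C i a * star (C j b))) • (dzGen n i * dzbarGen n j) :=
        Finset.sum_congr rfl fun i _ => Finset.sum_congr rfl fun a _ => Finset.sum_comm
    _ = _ := by
        refine Finset.sum_congr rfl fun i _ => Finset.sum_congr rfl fun j _ =>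
          Finset.sum_congr rfl fun b _ => Finset.sum_congr rfl fun a _ => ?_
        congr 1; ring

lemma map_lambda {m n : ℕ} (C : Matrix (Fin n) (Fin m) ℂ) (p q : ℕ) :
    (LambdaPQ m p q).map (ExteriorAlgebra.map (L C)).toLinearMap ≤ LambdaPQ n p q := by
  rw [lambda_eq, lambda_eq, Submodule.map_mul, Submodule.map_pow, Submodule.map_pow]
  refine mul_le_mul' (pow_le_pow_left' ?_ p) (pow_le_pow_left' ?_ q)
  · rw [DZ, Submodule.map_span, Submodule.span_le]
    rintro _ ⟨_, ⟨a, rfl⟩, rfl⟩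
    simp only [AlgHom.toLinearMap_apply, map_dz]
    exact Submodule.sum_mem _ fun i _ => Submodule.smul_mem _ _ (Submodule.subset_span ⟨i, rfl⟩)
  · rw [DZb, Submodule.map_span, Submodule.span_le]
    rintro _ ⟨_, ⟨a, rfl⟩, rfl⟩
    simp only [AlgHom.toLinearMap_apply, map_dzb]
    exact Submodule.sum_mem _ fun i _ => Submodule.smul_mem _ _ (Submodule.subset_span ⟨i, rfl⟩)

lemma map_inj {m n : ℕ} (C : Matrix (Fin n) (Fin m) ℂ) (D : Matrix (Fin m) (Fin n) ℂ)
    (h : D * C = 1) : Function.Injective (ExteriorAlgebra.map (L C)) := by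
  apply ExteriorAlgebra.map_injective
  refine ⟨L D, ?_⟩
  have h2 : D.map star * C.map star = 1 := by
    have := congrArg (fun M : Matrix (Fin m) (Fin m) ℂ => M.map (starRingEnd ℂ)) h
    simp only [Matrix.map_mul] at this
    simpa using this
  rw [L, L, ← Matrix.mulVecLin_mul, Matrix.fromBlocks_multiply, h, h2]
  simp [Matrix.fromBlocks_one]

lemma ker_le {n k : ℕ} (α : Fin k → Matrix (Fin n) (Fin n) ℂ) (hα : ∀ i, (α i).PosSemidef)
    (x : Fin n → ℂ) (hx : (∑ i, α i) *ᵥ x = 0) (i : Fin k) : α i *ᵥ x = 0 := by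
  rw [← (hα i).dotProduct_mulVec_zero_iff]
  have h : ∑ j, star x ⬝ᵥ (α j *ᵥ x) = 0 := by
    rw [← dotProduct_sum, ← Matrix.sum_mulVec, hx, dotProduct_zero]
  exact (Finset.sum_eq_zero_iff_of_nonneg
    (fun j _ => (hα j).dotProduct_mulVec_nonneg x)).mp h i (Finset.mem_univ i)

lemma exists_B {n m : ℕ} (hmn : m ≤ n) (S : Matrix (Fin n) (Fin n) ℂ) (hS : S.rank ≤ m) :
    ∃ (B : Matrix (Fin m) (Fin n) ℂ) (R : Matrix (Fin n) (Fin m) ℂ), B * R = 1 ∧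
      ∀ x, B *ᵥ x = 0 → S *ᵥ x = 0 := by
  have hr := LinearMap.finrank_range_add_finrank_ker S.mulVecLin
  rw [Matrix.rank] at hS
  rw [Module.finrank_fin_fun] at hr
  obtain ⟨g, hg⟩ := (finrank_le_iff_exists_linearMap (R := ℂ) (M := Fin (n - m) → ℂ)
    (M' := LinearMap.ker S.mulVecLin)).mp (by rw [Module.finrank_fin_fun]; omega)
  let j := (LinearMap.ker S.mulVecLin).subtype ∘ₗ g
  have hj : Function.Injective j := (Submodule.subtype_injective _).comp hg
  let K := LinearMap.range j
  have hK : Module.finrank ℂ K = n - m := by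
    rw [LinearMap.finrank_range_of_inj hj, Module.finrank_fin_fun]
  have hQ : Module.finrank ℂ ((Fin n → ℂ) ⧸ K) = Module.finrank ℂ (Fin m → ℂ) := by
    have := Submodule.finrank_quotient_add_finrank K
    rw [hK, Module.finrank_fin_fun] at this
    rw [Module.finrank_fin_fun]; omega
  let e := LinearEquiv.ofFinrankEq _ _ hQ
  let b := e.toLinearMap ∘ₗ K.mkQ
  have hb : Function.Surjective b := e.surjective.comp K.mkQ_surjective
  obtain ⟨r, hr'⟩ := LinearMap.exists_rightInverse_of_surjective b (LinearMap.range_eq_top.mpr hb)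
  refine ⟨LinearMap.toMatrix' b, LinearMap.toMatrix' r, ?_, ?_⟩
  · rw [← LinearMap.toMatrix'_comp, hr', LinearMap.toMatrix'_id]
  · intro x hx
    rw [LinearMap.toMatrix'_mulVec] at hx
    have hx2 : K.mkQ x = 0 := e.injective (by rw [map_zero]; exact hx)
    rw [Submodule.mkQ_apply, Submodule.Quotient.mk_eq_zero] at hx2
    obtain ⟨y, rfl⟩ := hx2
    exact LinearMap.mem_ker.mp (g y).2

end WNI

theorem wedge_not_injective_of_rank_small
    (n p q k : ℕ) (hp : 1 ≤ p) (hq : 1 ≤ q) (hk : 1 ≤ k) (hkn : k ≤ n - p - q)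
    (α : Fin k → Matrix (Fin n) (Fin n) ℂ) (hα : ∀ i, (α i).PosSemidef)
    (hrank : (∑ i, α i).rank ≤ k + p + q - 1) :
    ∃ Φ : ExteriorAlgebra ℂ (Fin n ⊕ Fin n → ℂ), Φ ∈ LambdaPQ n p q ∧ Φ ≠ 0 ∧
      (List.ofFn fun i => oneOneForm n (α i)).prod * Φ = 0 := by
  obtain ⟨B, R, hBR, hB⟩ := WNI.exists_B (by omega) _ hrank
  have hfac : ∀ i, α i = Bᴴ * (Rᴴ * α i * R) * Bᴴᴴ := by
    intro i
    have h1 : α i = α i * (R * B) := by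
      apply Matrix.ext_of_mulVec_single
      intro j
      have h2 : B *ᵥ (Pi.single j 1 - (R * B) *ᵥ Pi.single j 1) = 0 := by
        rw [Matrix.mulVec_sub, Matrix.mulVec_mulVec, ← Matrix.mul_assoc, hBR, Matrix.one_mul,
          sub_self]
      have h3 := WNI.ker_le α hα _ (hB _ h2) i
      rw [Matrix.mulVec_sub, Matrix.mulVec_mulVec, sub_eq_zero] at h3
      exact h3
    have h2 : α i = (R * B)ᴴ * α i := by
      have := congrArg Matrix.conjTranspose h1
      rwa [Matrix.conjTranspose_mul, (hα i).1.eq] at this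
    rw [Matrix.conjTranspose_conjTranspose]
    conv_lhs => rw [h2, h1, Matrix.conjTranspose_mul]
    simp only [Matrix.mul_assoc]
  obtain ⟨Φ, h1, h2, h3⟩ := WNI.core (k + p + q - 1) p q k hp hq hk (by omega)
    (fun i => Rᴴ * α i * R)
  have hinj := WNI.map_inj Bᴴ Rᴴ (by rw [← Matrix.conjTranspose_mul, hBR]; simp)
  refine ⟨ExteriorAlgebra.map (WNI.L Bᴴ) Φ, WNI.map_lambda _ p q ⟨Φ, h1, rfl⟩, ?_, ?_⟩
  · rwa [Ne, map_eq_zero_iff _ hinj]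
  · have h4 := congrArg (ExteriorAlgebra.map (WNI.L Bᴴ)) h3
    rw [map_mul, map_zero, map_list_prod, List.map_ofFn] at h4
    have h5 : (fun i => oneOneForm n (α i)) =
        (ExteriorAlgebra.map (WNI.L Bᴴ)) ∘ fun i => oneOneForm _ (Rᴴ * α i * R) := by
      funext i
      simp only [Function.comp_apply, WNI.map_oneOne, ← hfac]
    rw [h5]
    exact h4
end
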